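/- arXiv:1701.02776 — 2 statements merged into one kernel-verified Lean document; each statement's English description precedes it below -/
import Mathlib

section
/- Let (X_1,Y_1),...,(X_n,Y_n) be i.i.d. samples from a joint distribution p on a finite space X × Y. Then the plug-in estimate of entropy satisfies P(|Ĥ(X) − H(X)| > ε) ≤ (n+1)^{|X|}·exp(−c·n·ε⁴) with c = 1/(2|X|²·log 2). -/
open Finset
open scoped Classical

/-- Shannon entropy (in bits) of the distribution of a random variable `Y` on a finite
probability space with weights `μ`; with `μ` uniform on `Fin n` this is the empirical
entropy of a length-`n` sequence. -/
noncomputable def ent {Ω β : Type*} [Fintype Ω] [Fintype β] [DecidableEq β]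
    (μ : Ω → ℝ) (Y : Ω → β) : ℝ :=
  -∑ b : β, (∑ ω ∈ univ.filter (fun ω => Y ω = b), μ ω) *
      Real.logb 2 (∑ ω ∈ univ.filter (fun ω => Y ω = b), μ ω)

/-- Uniform weights `1/n` on `Fin n`: empirical distributions. -/
noncomputable def unif (n : ℕ) : Fin n → ℝ := fun _ => 1 / (n : ℝ)

lemma aux_gibbs {x y : ℝ} (hx : 0 ≤ x) (hy : 0 < y) :
    Real.negMulLog x + x * Real.log y ≤ y - x := by
  rcases hx.eq_or_lt with rfl | hx
  · simp [hy.le]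
  · have h := Real.log_le_sub_one_of_pos (div_pos hy hx)
    rw [Real.log_div hy.ne' hx.ne'] at h
    have h2 := mul_le_mul_of_nonneg_left h hx.le
    have h3 : x * (y / x - 1) = y - x := by field_simp
    rw [h3] at h2
    simp only [Real.negMulLog]
    linarith

lemma aux_eta_one_sub {x : ℝ} (h0 : 0 ≤ x) (h1 : x ≤ 1) :
    Real.negMulLog (1 - x) ≤ x - x ^ 2 / 2 - x ^ 3 / 6 := by
  rcases h1.eq_or_lt with rfl | h1
  · norm_num
  · have hlog : ∀ y : ℝ, 0 ≤ y → y < 1 → Real.log (1 - y) ≤ - y - y ^ 2 / 2 := by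
      intro y hy0 hy1
      have h := Real.hasSum_pow_div_log_of_abs_lt_one (x := y) (by rw [abs_of_nonneg hy0]; exact hy1)
      have h2 := sum_le_hasSum (Finset.range 2) (fun i _ => by positivity) h
      norm_num [Finset.sum_range_succ] at h2
      linarith
    have hd : ∀ y : ℝ, y < 1 → HasDerivAt
        (fun y : ℝ => y - y ^ 2 / 2 - y ^ 3 / 6 - Real.negMulLog (1 - y))
        (- y - y ^ 2 / 2 - Real.log (1 - y)) y := by
      intro y hy
      have hh : HasDerivAt (fun y : ℝ => 1 - y) (-1) y := by
        simpa using (hasDerivAt_id y).const_sub 1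
      have h1 := (Real.hasDerivAt_negMulLog (x := 1 - y) (by linarith)).comp y hh
      have h2 := (((hasDerivAt_id y).sub (((hasDerivAt_id y).pow 2).div_const 2)).sub
        (((hasDerivAt_id y).pow 3).div_const 6)).sub h1
      refine h2.congr_deriv ?_
      simp
      ring
    have hm : MonotoneOn (fun y : ℝ => y - y ^ 2 / 2 - y ^ 3 / 6 - Real.negMulLog (1 - y))
        (Set.Ico 0 1) := by
      apply monotoneOn_of_deriv_nonneg (convex_Ico 0 1)
      · intro y hy
        exact (hd y hy.2).continuousAt.continuousWithinAt
      · intro y hy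
        rw [interior_Ico] at hy
        exact (hd y hy.2).differentiableAt.differentiableWithinAt
      · intro y hy
        rw [interior_Ico] at hy
        rw [(hd y hy.2).deriv]
        linarith [hlog y hy.1.le hy.2]
    have := hm (a := 0) (b := x) (by simp) ⟨h0, h1⟩ h0
    simp at this
    linarith

lemma aux_numer {K t0 s S t Λ : ℝ} (hK : 0 < K) (ht0 : 0 < t0) (hs : 0 ≤ s) (ht : 0 < t)
    (ht1 : t ≤ 1) (hΛ : Real.log (K / t0 ^ 2) ≤ Λ)
    (hA : 2 * t0 + s ^ 3 + 2 / 3 * s ^ 5 ≤ S)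
    (hB : 2 * t0 + s ^ 3 + 2 / 3 * s ^ 5 + Λ - 1 - 3 / 2 * s ^ 2 - 5 / 6 * s ^ 4 ≤ S) :
    t ^ 2 * Real.log K + Real.negMulLog (t ^ 2) + Real.negMulLog (1 - t ^ 2) ≤ S * t := by
  have h1 := aux_eta_one_sub (x := t ^ 2) (by positivity) (by nlinarith)
  have h2 := aux_gibbs ht.le ht0
  have h3 : Real.negMulLog (t ^ 2) = 2 * t * Real.negMulLog t := by
    simp only [Real.negMulLog, Real.log_pow]; push_cast; ring
  rw [Real.log_div hK.ne' (by positivity), Real.log_pow] at hΛ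
  push_cast at hΛ
  have c3 : 3 * s ^ 2 * t - 2 * s ^ 3 ≤ t ^ 3 := by
    have : t ^ 3 - (3 * s ^ 2 * t - 2 * s ^ 3) = (t - s) ^ 2 * (t + 2 * s) := by ring
    have h : 0 ≤ (t - s) ^ 2 * (t + 2 * s) := by positivity
    linarith
  have c5 : 5 * s ^ 4 * t - 4 * s ^ 5 ≤ t ^ 5 := by
    have : t ^ 5 - (5 * s ^ 4 * t - 4 * s ^ 5)
      = (t - s) ^ 2 * (t ^ 3 + 2 * t ^ 2 * s + 3 * t * s ^ 2 + 4 * s ^ 3) := by ring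
    have h : 0 ≤ (t - s) ^ 2 * (t ^ 3 + 2 * t ^ 2 * s + 3 * t * s ^ 2 + 4 * s ^ 3) := by positivity
    linarith
  have key : 2 * t0 + t * (Λ - 1) - t ^ 3 / 2 - t ^ 5 / 6 ≤ S := by
    have e1 := mul_le_mul_of_nonneg_left hA (sub_nonneg.2 ht1)
    have e2 := mul_le_mul_of_nonneg_left hB ht.le
    nlinarith
  have hn : Real.negMulLog t ≤ t0 - t - t * Real.log t0 := by linarith
  have e3 := mul_le_mul_of_nonneg_left hn (by positivity : 0 ≤ 2 * t)
  have e4 := mul_le_mul_of_nonneg_left key ht.le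
  have e5 := mul_le_mul_of_nonneg_left hΛ (by positivity : 0 ≤ t ^ 2)
  rw [h3]
  nlinarith

lemma aux_log_rat {N : ℝ} (hN : 0 < N) (a b : ℕ) (ha : 0 < a) (h : N ^ a ≤ 2 ^ b) :
    Real.log N ≤ (b / a : ℝ) * 0.6931471808 := by
  have h1 := Real.log_le_log (by positivity) h
  rw [Real.log_pow, Real.log_pow] at h1
  have ha' : (0 : ℝ) < a := by exact_mod_cast ha
  have h2 : Real.log N ≤ (b / a : ℝ) * Real.log 2 := by
    rw [div_mul_eq_mul_div, le_div_iff₀ ha']; linarith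
  refine h2.trans ?_
  apply mul_le_mul_of_nonneg_left Real.log_two_lt_d9.le (by positivity)

lemma aux_large {k : ℕ} (hk : 13 ≤ k) :
    ∃ t0 s S Λ : ℝ, 0 < t0 ∧ 0 ≤ s ∧ 0 ≤ S ∧ S ^ 2 ≤ 0.8 * k ∧
      Real.log (((k : ℝ) - 1) / t0 ^ 2) ≤ Λ ∧ 2 * t0 + s ^ 3 + 2 / 3 * s ^ 5 ≤ S ∧
      2 * t0 + s ^ 3 + 2 / 3 * s ^ 5 + Λ - 1 - 3 / 2 * s ^ 2 - 5 / 6 * s ^ 4 ≤ S := by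
  have hk' : (13 : ℝ) ≤ k := by exact_mod_cast hk
  set y := Real.sqrt k with hy
  have hyy : y ^ 2 = k := Real.sq_sqrt (by positivity)
  have hy36 : 3.6 ≤ y := by
    apply Real.le_sqrt_of_sq_le; norm_num; linarith
  refine ⟨1, 0.9, 0.894 * y, y / 2 + 0.7726, by norm_num, by norm_num, by positivity, ?_, ?_, ?_, ?_⟩
  · rw [← hyy]; nlinarith
  · have h1 : Real.log (((k : ℝ) - 1) / 1 ^ 2) ≤ Real.log k := by
      apply Real.log_le_log <;> norm_num <;> linarith
    have h2 : Real.log (k : ℝ) = 2 * Real.log y := by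
      rw [← hyy, Real.log_pow]; norm_num
    have h3 := Real.log_le_sub_one_of_pos (x := y / 4) (by positivity)
    rw [Real.log_div (by positivity) (by norm_num), show (4 : ℝ) = 2 ^ 2 by norm_num,
      Real.log_pow] at h3
    have := Real.log_two_lt_d9
    push_cast at h3
    linarith
  · norm_num; linarith
  · norm_num; linarith

lemma aux_small {k : ℕ} (hk2 : 2 ≤ k) (hk : k ≤ 12) :
    ∃ t0 s S Λ : ℝ, 0 < t0 ∧ 0 ≤ s ∧ 0 ≤ S ∧ S ^ 2 ≤ 0.8 * k ∧
      Real.log (((k : ℝ) - 1) / t0 ^ 2) ≤ Λ ∧ 2 * t0 + s ^ 3 + 2 / 3 * s ^ 5 ≤ S ∧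
      2 * t0 + s ^ 3 + 2 / 3 * s ^ 5 + Λ - 1 - 3 / 2 * s ^ 2 - 5 / 6 * s ^ 4 ≤ S := by
  have main : ∀ (t0 s S : ℝ) (a b : ℕ), 0 < t0 → 0 ≤ s → 0 ≤ S → S ^ 2 ≤ 0.8 * k → 0 < a →
      (((k : ℝ) - 1) / t0 ^ 2) ^ a ≤ 2 ^ b → 2 * t0 + s ^ 3 + 2 / 3 * s ^ 5 ≤ S →
      2 * t0 + s ^ 3 + 2 / 3 * s ^ 5 + (b / a : ℝ) * 0.6931471808
        - 1 - 3 / 2 * s ^ 2 - 5 / 6 * s ^ 4 ≤ S →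
      ∃ t0 s S Λ : ℝ, 0 < t0 ∧ 0 ≤ s ∧ 0 ≤ S ∧ S ^ 2 ≤ 0.8 * k ∧
      Real.log (((k : ℝ) - 1) / t0 ^ 2) ≤ Λ ∧ 2 * t0 + s ^ 3 + 2 / 3 * s ^ 5 ≤ S ∧
      2 * t0 + s ^ 3 + 2 / 3 * s ^ 5 + Λ - 1 - 3 / 2 * s ^ 2 - 5 / 6 * s ^ 4 ≤ S :=
    fun t0 s S a b h1 h2 h3 h4 h5 h6 h7 h8 =>
    ⟨t0, s, S, (b / a : ℝ) * 0.6931471808, h1, h2, h3, h4,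
      aux_log_rat (div_pos (by
        have : (2 : ℝ) ≤ k := by exact_mod_cast hk2
        linarith) (by positivity)) a b h5 h6, h7, h8⟩
  interval_cases k
  · apply main 0.49 0.5 1.264 7 15 <;> norm_num
  · apply main 0.62 0.6 1.549 5 12 <;> norm_num
  · apply main 0.69 0.67 1.788 3 8 <;> norm_num
  · apply main 0.71 0.74 2 1 3 <;> norm_num
  · apply main 0.75 0.77 2.19 6 19 <;> norm_num
  · apply main 0.79 0.79 2.366 7 23 <;> norm_num
  · apply main 0.82 0.81 2.529 5 17 <;> norm_num
  · apply main 0.84 0.83 2.683 5 18 <;> norm_num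
  · apply main 0.85 0.85 2.828 3 11 <;> norm_num
  · apply main 0.87 0.86 2.966 4 15 <;> norm_num
  · apply main 0.87 0.88 3.098 1 4 <;> norm_num

lemma aux_f_sq {k : ℕ} (hk : 2 ≤ k) {T : ℝ} (hT : 0 < T) (hT1 : T ≤ 1) :
    ∃ S : ℝ, 0 ≤ S ∧ S ^ 2 ≤ 0.8 * k * T ∧
    T * Real.log ((k : ℝ) - 1) + Real.negMulLog T + Real.negMulLog (1 - T) ≤ S := by
  have : ∃ t0 s S Λ : ℝ, 0 < t0 ∧ 0 ≤ s ∧ 0 ≤ S ∧ S ^ 2 ≤ 0.8 * k ∧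
      Real.log (((k : ℝ) - 1) / t0 ^ 2) ≤ Λ ∧ 2 * t0 + s ^ 3 + 2 / 3 * s ^ 5 ≤ S ∧
      2 * t0 + s ^ 3 + 2 / 3 * s ^ 5 + Λ - 1 - 3 / 2 * s ^ 2 - 5 / 6 * s ^ 4 ≤ S := by
    rcases le_or_gt k 12 with h | h
    · exact aux_small hk h
    · exact aux_large h
  obtain ⟨t0, s, S, Λ, h1, h2, h3, h4, h5, h6, h7⟩ := this
  have hk' : (2 : ℝ) ≤ k := by exact_mod_cast hk
  have hsq : Real.sqrt T ^ 2 = T := Real.sq_sqrt hT.le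
  have h := aux_numer (K := (k : ℝ) - 1) (t := Real.sqrt T) (by linarith) h1 h2
    (Real.sqrt_pos.2 hT) (Real.sqrt_le_one.2 hT1) h5 h6 h7
  rw [hsq] at h
  refine ⟨S * Real.sqrt T, by positivity, ?_, h⟩
  rw [mul_pow, hsq]
  exact mul_le_mul_of_nonneg_right h4 hT.le

lemma aux_pade {x : ℝ} (hx : 0 < x) :
    (x - 1) * (5 * x + 1) / (2 * x * (x + 2)) ≤ Real.log x := by
  have hd : ∀ y : ℝ, 0 < y → HasDerivAt
      (fun y : ℝ => Real.log y - (y - 1) * (5 * y + 1) / (2 * y * (y + 2)))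
      ((y - 1) ^ 3 / (y ^ 2 * (y + 2) ^ 2)) y := by
    intro y hy
    have hi := hasDerivAt_id y
    have h1 := (hi.sub_const 1).mul ((hi.const_mul 5).add_const 1)
    have h2 := (hi.const_mul 2).mul (hi.add_const 2)
    have h3 := (Real.hasDerivAt_log hy.ne').sub (h1.div h2 (by simp; constructor <;> linarith))
    refine h3.congr_deriv ?_
    simp
    field_simp
    ring
  rcases le_total 1 x with h | h
  · have hm : MonotoneOn (fun y : ℝ => Real.log y - (y - 1) * (5 * y + 1) / (2 * y * (y + 2)))
        (Set.Ici 1) := by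
      apply monotoneOn_of_deriv_nonneg (convex_Ici 1)
      · intro y hy
        exact (hd y (lt_of_lt_of_le one_pos hy)).continuousAt.continuousWithinAt
      · intro y hy
        rw [interior_Ici] at hy
        exact (hd y (lt_trans one_pos hy)).differentiableAt.differentiableWithinAt
      · intro y hy
        rw [interior_Ici] at hy
        rw [(hd y (lt_trans one_pos hy)).deriv]
        have : 0 ≤ y - 1 := by have : 1 < y := hy; linarith
        positivity
    have := hm (a := 1) (b := x) (by simp) h h
    simp at this
    linarith
  · have hm : AntitoneOn (fun y : ℝ => Real.log y - (y - 1) * (5 * y + 1) / (2 * y * (y + 2)))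
        (Set.Ioc 0 1) := by
      apply antitoneOn_of_deriv_nonpos (convex_Ioc 0 1)
      · intro y hy
        exact (hd y hy.1).continuousAt.continuousWithinAt
      · intro y hy
        rw [interior_Ioc] at hy
        exact (hd y hy.1).differentiableAt.differentiableWithinAt
      · intro y hy
        rw [interior_Ioc] at hy
        rw [(hd y hy.1).deriv]
        apply div_nonpos_of_nonpos_of_nonneg _ (by positivity)
        have : 0 ≤ (1 - y) ^ 3 := pow_nonneg (by linarith [hy.2]) 3
        nlinarith
    have := hm (a := x) (b := 1) ⟨hx, h⟩ (by simp) h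
    simp at this
    linarith

/-- pointwise Pinsker -/
lemma aux_pinsker_pt {p q : ℝ} (hp : 0 ≤ p) (hq : 0 ≤ q) (hpq : p = 0 → q = 0) :
    (p - q) ^ 2 ≤ (2 * q + 4 * p) / 3 * (q * Real.log (q / p) - q + p) := by
  rcases hp.eq_or_lt with rfl | hp
  · simp [hpq rfl]
  rcases hq.eq_or_lt with rfl | hq
  · simp; nlinarith
  have h := aux_pade (div_pos hq hp)
  have e : (q / p - 1) * (5 * (q / p) + 1) / (2 * (q / p) * (q / p + 2))
      = (q - p) * (5 * q + p) / (2 * q * (q + 2 * p)) := by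
    field_simp
  rw [e, div_le_iff₀ (by positivity)] at h
  nlinarith

lemma aux_pinsker {X : Type*} [Fintype X] (p q : X → ℝ) (hp : ∀ a, 0 ≤ p a) (hq : ∀ a, 0 ≤ q a)
    (hp1 : ∑ a, p a = 1) (hq1 : ∑ a, q a = 1) (hpq : ∀ a, p a = 0 → q a = 0) :
    (∑ a, |p a - q a|) ^ 2 ≤ 2 * ∑ a, q a * Real.log (q a / p a) := by
  have hnn : ∀ a, 0 ≤ q a * Real.log (q a / p a) - q a + p a := by
    intro a
    rcases (hp a).eq_or_lt with h | h
    · simp [← h, hpq a h.symm]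
    have h1 := aux_gibbs (hq a) h
    rcases (hq a).eq_or_lt with h' | h'
    · simp [← h', h.le]
    rw [Real.log_div h'.ne' h.ne']
    simp only [Real.negMulLog] at h1
    nlinarith
  have h := Finset.sum_sq_le_sum_mul_sum_of_sq_le_mul Finset.univ
    (r := fun a => |p a - q a|) (f := fun a => (2 * q a + 4 * p a) / 3)
    (g := fun a => q a * Real.log (q a / p a) - q a + p a)
    (fun a _ => by have := hp a; have := hq a; positivity) (fun a _ => hnn a)
    (fun a _ => by rw [sq_abs]; exact aux_pinsker_pt (hp a) (hq a) (hpq a))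
  refine h.trans (le_of_eq ?_)
  rw [← Finset.sum_div, Finset.sum_add_distrib, ← Finset.mul_sum, ← Finset.mul_sum,
    Finset.sum_add_distrib, Finset.sum_sub_distrib, hp1, hq1]
  ring

lemma aux_subadd {m r : ℝ} (hm : 0 ≤ m) (hr : 0 ≤ r) :
    Real.negMulLog (m + r) ≤ Real.negMulLog m + Real.negMulLog r := by
  rcases hm.eq_or_lt with rfl | hm
  · simp
  rcases hr.eq_or_lt with rfl | hr
  · simp
  have h1 := Real.log_le_log hm (by linarith : m ≤ m + r)
  have h2 := Real.log_le_log hr (by linarith : r ≤ m + r)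
  simp only [Real.negMulLog]
  nlinarith

lemma aux_lower {m s T : ℝ} (hm : 0 ≤ m) (hs : 0 ≤ s) (hmT : m ≤ 1 - T) (hsT : s ≤ T) :
    Real.negMulLog m + m * Real.log (1 - T) ≤ Real.negMulLog (m + s) := by
  have hT : 0 ≤ T := hs.trans hsT
  rcases hm.eq_or_lt with rfl | hm
  · simp; exact Real.negMulLog_nonneg hs (by linarith)
  rcases hs.eq_or_lt with rfl | hs
  · have := Real.log_nonpos (by linarith : 0 ≤ 1 - T) (by linarith)
    simp; nlinarith
  have hT1 : 0 < 1 - T := by linarith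
  have hT0 : 0 < T := by linarith
  have h1 := aux_gibbs hm.le (mul_pos hT1 (by linarith : 0 < m + s))
  have h2 := aux_gibbs hs.le (mul_pos hT0 (by linarith : 0 < m + s))
  rw [Real.log_mul hT1.ne' (by linarith)] at h1
  rw [Real.log_mul hT0.ne' (by linarith)] at h2
  have h3 := mul_le_mul_of_nonneg_left (Real.log_le_log hs hsT) hs.le
  simp only [Real.negMulLog] at *
  nlinarith

lemma aux_fannes {X : Type*} [Fintype X] (p q : X → ℝ) (hp : ∀ a, 0 ≤ p a) (hq : ∀ a, 0 ≤ q a)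
    (hp1 : ∑ a, p a = 1) (hq1 : ∑ a, q a = 1) (T : ℝ) (hT : ∑ a, |p a - q a| = 2 * T)
    (hT0 : 0 < T) :
    2 ≤ Fintype.card X ∧ T ≤ 1 ∧ ∑ a, Real.negMulLog (p a) - ∑ a, Real.negMulLog (q a) ≤
      T * Real.log ((Fintype.card X : ℝ) - 1) + Real.negMulLog T + Real.negMulLog (1 - T) := by
  classical
  set m : X → ℝ := fun a => min (p a) (q a) with hmdef
  set r : X → ℝ := fun a => p a - m a with hrdef
  set s : X → ℝ := fun a => q a - m a with hsdef
  have hm : ∀ a, 0 ≤ m a := fun a => le_min (hp a) (hq a)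
  have hr : ∀ a, 0 ≤ r a := fun a => sub_nonneg.2 (min_le_left _ _)
  have hs : ∀ a, 0 ≤ s a := fun a => sub_nonneg.2 (min_le_right _ _)
  have hrs : ∀ a, r a + s a = |p a - q a| := by
    intro a
    simp only [hrdef, hsdef, hmdef]
    rcases le_total (p a) (q a) with h | h
    · rw [min_eq_left h, abs_of_nonpos (by linarith)]; ring
    · rw [min_eq_right h, abs_of_nonneg (by linarith)]; ring
  have hsumr : ∑ a, r a = 1 - ∑ a, m a := by rw [Finset.sum_sub_distrib, hp1]
  have hsums : ∑ a, s a = 1 - ∑ a, m a := by rw [Finset.sum_sub_distrib, hq1]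
  have hsum2 : ∑ a, r a + ∑ a, s a = 2 * T := by
    rw [← hT, ← Finset.sum_add_distrib]; exact Finset.sum_congr rfl fun a _ => hrs a
  have hmT : ∑ a, m a = 1 - T := by linarith
  have hrT : ∑ a, r a = T := by linarith
  have hsT : ∑ a, s a = T := by linarith
  have hT1 : T ≤ 1 := by
    have := Finset.sum_nonneg (fun a (_ : a ∈ Finset.univ) => hm a)
    linarith
  obtain ⟨a0, -, ha0⟩ : ∃ a ∈ Finset.univ, 0 < s a := by
    by_contra! h
    have := Finset.sum_nonpos h
    linarith
  have hra0 : r a0 = 0 := by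
    simp only [hrdef, hsdef, hmdef] at *
    rcases le_total (p a0) (q a0) with h | h
    · rw [min_eq_left h]; ring
    · rw [min_eq_right h] at ha0; linarith
  obtain ⟨a1, -, ha1⟩ : ∃ a ∈ Finset.univ, 0 < r a := by
    by_contra! h
    have := Finset.sum_nonpos h
    linarith
  have hne : a0 ≠ a1 := by rintro rfl; linarith
  have hk : 2 ≤ Fintype.card X := Fintype.one_lt_card_iff.2 ⟨a0, a1, hne⟩
  have hk' : (2 : ℝ) ≤ Fintype.card X := by exact_mod_cast hk
  refine ⟨hk, hT1, ?_⟩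
  have hcard : ((Finset.univ.erase a0).card : ℝ) = (Fintype.card X : ℝ) - 1 := by
    rw [Finset.card_erase_of_mem (Finset.mem_univ _), Finset.card_univ,
      Nat.cast_sub (by omega), Nat.cast_one]
  set K : ℝ := (Fintype.card X : ℝ) - 1 with hK
  have hK0 : 0 < K := by linarith
  have hA : ∑ a, Real.negMulLog (r a) ≤ T * Real.log K + Real.negMulLog T := by
    have h1 : ∑ a ∈ Finset.univ.erase a0, r a = T := by
      rw [Finset.sum_erase _ hra0, hrT]
    have h2 : ∑ a ∈ Finset.univ.erase a0, Real.negMulLog (r a) = ∑ a, Real.negMulLog (r a) := by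
      rw [Finset.sum_erase _ (by simp [hra0])]
    rw [← h2]
    have h3 := Finset.sum_le_sum (s := Finset.univ.erase a0)
      (fun a _ => aux_gibbs (hr a) (div_pos hT0 hK0))
    rw [Finset.sum_add_distrib, Finset.sum_sub_distrib, ← Finset.sum_mul, h1, Finset.sum_const,
      nsmul_eq_mul, hcard, mul_div_cancel₀ _ hK0.ne', Real.log_div hT0.ne' hK0.ne'] at h3
    simp only [Real.negMulLog] at *
    linarith
  have hB : ∑ a, Real.negMulLog (p a) ≤ ∑ a, Real.negMulLog (m a) + ∑ a, Real.negMulLog (r a) := by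
    rw [← Finset.sum_add_distrib]
    refine Finset.sum_le_sum fun a _ => ?_
    have := aux_subadd (hm a) (hr a)
    rwa [show m a + r a = p a by simp [hrdef]] at this
  have hC : ∑ a, Real.negMulLog (m a) + (1 - T) * Real.log (1 - T)
      ≤ ∑ a, Real.negMulLog (q a) := by
    rw [← hmT, Finset.sum_mul, ← Finset.sum_add_distrib, hmT]
    refine Finset.sum_le_sum fun a _ => ?_
    have := aux_lower (hm a) (hs a)
      (hmT ▸ Finset.single_le_sum (fun a _ => hm a) (Finset.mem_univ a))
      (hsT ▸ Finset.single_le_sum (fun a _ => hs a) (Finset.mem_univ a))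
    rwa [show m a + s a = q a by simp [hsdef]] at this
  have hD : Real.negMulLog (1 - T) = -((1 - T) * Real.log (1 - T)) := by
    simp only [Real.negMulLog]; ring
  linarith

lemma aux_core {X : Type*} [Fintype X] (p q : X → ℝ) (hp : ∀ a, 0 ≤ p a) (hq : ∀ a, 0 ≤ q a)
    (hp1 : ∑ a, p a = 1) (hq1 : ∑ a, q a = 1) (hpq : ∀ a, p a = 0 → q a = 0)
    (ε : ℝ) (hε : 0 < ε)
    (h : ε < |(-∑ a, q a * Real.logb 2 (q a)) - (-∑ a, p a * Real.logb 2 (p a))|) :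
    1 / (2 * (Fintype.card X : ℝ) ^ 2 * Real.log 2) * ε ^ 4
      ≤ ∑ a, q a * Real.log (q a / p a) := by
  have hL := Real.log_two_gt_d9
  have hent : ∀ u : X → ℝ, -∑ a, u a * Real.logb 2 (u a)
      = (∑ a, Real.negMulLog (u a)) / Real.log 2 := by
    intro u
    rw [Finset.sum_div, ← Finset.sum_neg_distrib]
    refine Finset.sum_congr rfl fun a _ => ?_
    simp only [Real.negMulLog, Real.logb]; ring
  rw [hent, hent, ← sub_div, abs_div, abs_of_pos (by linarith : 0 < Real.log 2),
    lt_div_iff₀ (by linarith)] at h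
  obtain ⟨T, hT⟩ : ∃ T, ∑ a, |p a - q a| = 2 * T := ⟨(∑ a, |p a - q a|) / 2, by ring⟩
  have hT' : ∑ a, |q a - p a| = 2 * T := by
    rw [← hT]; exact Finset.sum_congr rfl fun a _ => abs_sub_comm _ _
  have hTnn : 0 ≤ 2 * T := hT ▸ Finset.sum_nonneg fun a _ => abs_nonneg _
  have hT0 : 0 < T := by
    rcases (by linarith : 0 ≤ T).eq_or_lt with h0 | h0
    · exfalso
      rw [← h0, mul_zero, Finset.sum_eq_zero_iff_of_nonneg (fun a _ => abs_nonneg _)] at hT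
      have : p = q := by
        funext a
        have := hT a (Finset.mem_univ a)
        rw [abs_eq_zero] at this
        linarith
      rw [this] at h
      simp at h
      have := mul_pos hε (by linarith : 0 < Real.log 2)
      linarith
    · exact h0
  obtain ⟨hk, hT1, h1⟩ := aux_fannes p q hp hq hp1 hq1 T hT hT0
  obtain ⟨-, -, h2⟩ := aux_fannes q p hq hp hq1 hp1 T hT' hT0
  obtain ⟨S, hS0, hS2, hS⟩ := aux_f_sq hk hT0 hT1
  have h3 : ε * Real.log 2 ≤ S := h.le.trans (abs_le.2 ⟨by linarith, by linarith⟩)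
  have hpin := aux_pinsker p q hp hq hp1 hq1 hpq
  rw [hT] at hpin
  have hk' : (2 : ℝ) ≤ Fintype.card X := by exact_mod_cast hk
  set k : ℝ := (Fintype.card X : ℝ)
  set L := Real.log 2
  have hL0 : 0 < L := by linarith
  have h4 : (ε * L) ^ 2 ≤ 0.8 * k * T := (pow_le_pow_left₀ (by positivity) h3 2).trans hS2
  have h5 : ((ε * L) ^ 2) ^ 2 ≤ (0.8 * k * T) ^ 2 := pow_le_pow_left₀ (by positivity) h4 2
  have h6 : (0.16 : ℝ) ≤ L ^ 5 :=
    le_trans (by norm_num) (pow_le_pow_left₀ (by norm_num) hL.le 5)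
  have h7 : ε ^ 4 * L ^ 4 ≤ 4 * k ^ 2 * T ^ 2 * L * L ^ 4 := by
    have : 0.64 * (k ^ 2 * T ^ 2) ≤ 4 * L ^ 5 * (k ^ 2 * T ^ 2) :=
      mul_le_mul_of_nonneg_right (by linarith) (by positivity)
    nlinarith
  have h8 := le_of_mul_le_mul_right h7 (by positivity)
  rw [div_mul_eq_mul_div, one_mul, div_le_iff₀ (by positivity)]
  have h9 : (k ^ 2 * L) * (2 * T) ^ 2 ≤ (k ^ 2 * L) * (2 * ∑ a, q a * Real.log (q a / p a)) :=
    mul_le_mul_of_nonneg_left hpin (by positivity)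
  nlinarith

lemma aux_marg {X Y : Type*} [Fintype X] [Fintype Y] (n : ℕ) (p : X × Y → ℝ)
    (A : (Fin n → X) → Prop) :
    (∑ ω : Fin n → X × Y, if A (fun i => (ω i).1) then ∏ i, p (ω i) else 0)
      = ∑ x : Fin n → X, if A x then ∏ i, ∑ b : Y, p (x i, b) else 0 := by
  rw [← Equiv.sum_comp (Equiv.arrowProdEquivProdArrow (Fin n) (fun _ => X) (fun _ => Y)).symm,
    Fintype.sum_prod_type]
  refine Finset.sum_congr rfl fun x _ => ?_
  simp only [Equiv.arrowProdEquivProdArrow, Equiv.coe_fn_symm_mk]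
  by_cases h : A x
  · simp only [h, if_true]
    rw [Finset.prod_univ_sum, Fintype.piFinset_univ]
  · simp [h]

/-- count of a letter in a word, as an element of `Fin (n+1)` -/
noncomputable def auxType {X : Type*} (n : ℕ) (x : Fin n → X) : X → Fin (n + 1) := fun a =>
  ⟨(univ.filter (fun i => x i = a)).card,
    Nat.lt_succ_of_le ((Finset.card_filter_le _ _).trans (by simp))⟩

lemma aux_type_sum {X : Type*} [Fintype X] (n : ℕ) (x : Fin n → X) :
    ∑ a, ((auxType n x a : ℕ) : ℝ) = n := by
  have h := Finset.card_eq_sum_card_fiberwise (f := x) (s := univ) (t := univ) (by simp)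
  simp only [Finset.card_univ, Fintype.card_fin] at h
  simp only [auxType]
  rw [← Nat.cast_sum]
  congr 1
  exact h.symm

lemma aux_type_zero {X : Type*} (n : ℕ) (x : Fin n → X) (a : X) (h : ∀ i, x i ≠ a) :
    (auxType n x a : ℕ) = 0 := by
  simp only [auxType]
  rw [Finset.card_eq_zero, Finset.filter_eq_empty_iff]
  exact fun i _ => h i

lemma aux_count {X : Type*} [Fintype X] (n : ℕ) (q : (X → Fin (n + 1)) → X → ℝ)
    (hq : ∀ N a, 0 ≤ q N a) (h1 : ∀ x : Fin n → X, ∑ a, q (auxType n x) a = 1) :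
    ∑ x : Fin n → X, ∏ i, q (auxType n x) (x i) ≤ ((n : ℝ) + 1) ^ Fintype.card X := by
  rw [← Finset.sum_fiberwise univ (auxType n)]
  have : ∀ N : X → Fin (n + 1),
      ∑ x ∈ univ.filter (fun x => auxType n x = N), ∏ i, q (auxType n x) (x i) ≤ 1 := by
    intro N
    rcases (univ.filter (fun x : Fin n → X => auxType n x = N)).eq_empty_or_nonempty with h | ⟨x0, h⟩
    · rw [h]; simp
    · have hx0 : auxType n x0 = N := by simpa using h
      calc ∑ x ∈ univ.filter (fun x => auxType n x = N), ∏ i, q (auxType n x) (x i)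
          = ∑ x ∈ univ.filter (fun x => auxType n x = N), ∏ i, q N (x i) := by
            refine Finset.sum_congr rfl fun x hx => ?_
            rw [(Finset.mem_filter.1 hx).2]
        _ ≤ ∑ x : Fin n → X, ∏ i, q N (x i) :=
            Finset.sum_le_sum_of_subset_of_nonneg (Finset.filter_subset _ _)
              (fun x _ _ => Finset.prod_nonneg fun i _ => hq _ _)
        _ = ∏ i : Fin n, ∑ a, q N a := by
            rw [Finset.prod_univ_sum, Fintype.piFinset_univ]
        _ = 1 := by rw [← hx0, h1]; simp
  refine (Finset.sum_le_sum fun N _ => this N).trans ?_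
  simp

lemma aux_tilt {X : Type*} [Fintype X] (n : ℕ) (hn : 0 < n) (P : X → ℝ) (x : Fin n → X)
    (hP : ∀ i, 0 < P (x i)) (q : X → ℝ) (hq : ∀ a, q a = ((auxType n x a : ℕ) : ℝ) / n) :
    ∏ i, P (x i) = Real.exp (- (n * ∑ a, q a * Real.log (q a / P a))) * ∏ i, q (x i) := by
  have hn' : (0 : ℝ) < n := by exact_mod_cast hn
  have hqpos : ∀ i, 0 < q (x i) := by
    intro i
    rw [hq]
    apply div_pos _ hn'
    have : 0 < (univ.filter (fun j => x j = x i)).card := Finset.card_pos.2 ⟨i, by simp⟩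
    exact_mod_cast this
  have h1 : (n * ∑ a, q a * Real.log (q a / P a)) = ∑ i, Real.log (q (x i) / P (x i)) := by
    rw [Finset.mul_sum, ← Finset.sum_fiberwise univ x]
    refine Finset.sum_congr rfl fun a _ => ?_
    rw [Finset.sum_congr rfl (g := fun _ => Real.log (q a / P a))
      (fun i hi => by rw [(Finset.mem_filter.1 hi).2]), Finset.sum_const, nsmul_eq_mul, ← mul_assoc]
    congr 1
    rw [hq, mul_div_cancel₀ _ hn'.ne']
    simp [auxType]
  rw [h1, ← Finset.sum_neg_distrib, Real.exp_sum, ← Finset.prod_mul_distrib]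
  refine Finset.prod_congr rfl fun i _ => ?_
  rw [Real.exp_neg, Real.exp_log (div_pos (hqpos i) (hP i))]
  have := hqpos i
  field_simp

/-- Concentration of the plug-in entropy estimate: for `n` i.i.d. samples from a joint
distribution `p` on a finite space `X × Y`,
`P(|Ĥ(X) − H(X)| > ε) ≤ (n+1)^{|X|}·exp(−c·n·ε⁴)` with `c = 1/(2|X|²·log 2)`. -/
theorem stmt15 {X Y : Type*} [Fintype X] [DecidableEq X] [Fintype Y] [DecidableEq Y]
    (n : ℕ) (hn : 0 < n) (p : X × Y → ℝ) (hp : ∀ z, 0 ≤ p z) (hsum : ∑ z, p z = 1)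
    (ε : ℝ) (hε : 0 < ε) :
    (∑ ω ∈ univ.filter (fun ω : Fin n → X × Y =>
        ε < |ent (unif n) (fun i => (ω i).1)
              - (-∑ a : X, (∑ b : Y, p (a, b)) * Real.logb 2 (∑ b : Y, p (a, b)))|),
      ∏ i, p (ω i))
      ≤ ((n : ℝ) + 1) ^ (Fintype.card X) *
          Real.exp (-(1 / (2 * ((Fintype.card X : ℝ))^2 * Real.log 2)) * n * ε^4) := by
  have hn' : (0 : ℝ) < n := by exact_mod_cast hn
  set P : X → ℝ := fun a => ∑ b : Y, p (a, b) with hPdef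
  have hP : ∀ a, 0 ≤ P a := fun a => Finset.sum_nonneg fun b _ => hp _
  have hP1 : ∑ a, P a = 1 := by rw [← hsum, Fintype.sum_prod_type]
  set q : (X → Fin (n + 1)) → X → ℝ := fun N a => ((N a : ℕ) : ℝ) / n with hqdef
  have hq : ∀ N a, 0 ≤ q N a := fun N a => by simp only [hqdef]; positivity
  have hq1 : ∀ x : Fin n → X, ∑ a, q (auxType n x) a = 1 := by
    intro x
    simp only [hqdef]
    rw [← Finset.sum_div, aux_type_sum, div_self hn'.ne']
  have hent : ∀ x : Fin n → X, ent (unif n) x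
      = -∑ a, q (auxType n x) a * Real.logb 2 (q (auxType n x) a) := by
    intro x
    have : ∀ a, ∑ i ∈ univ.filter (fun i => x i = a), unif n i = q (auxType n x) a := by
      intro a
      simp only [unif, hqdef, auxType, Finset.sum_const, nsmul_eq_mul, mul_one_div]
      congr!
    simp only [ent]
    congr 1
    refine Finset.sum_congr rfl fun a _ => ?_
    rw [← this]
  rw [Finset.sum_filter]
  have hmarg := aux_marg n p (fun x => ε < |ent (unif n) x - (-∑ a, P a * Real.logb 2 (P a))|)
  set δ := 1 / (2 * ((Fintype.card X : ℝ))^2 * Real.log 2) * ε ^ 4 with hδ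
  have hexp : Real.exp (-(1 / (2 * ((Fintype.card X : ℝ))^2 * Real.log 2)) * n * ε^4)
      = Real.exp (-(n * δ)) := by congr 1; rw [hδ]; ring
  rw [hexp]
  calc _ = ∑ x : Fin n → X, if ε < |ent (unif n) x - (-∑ a, P a * Real.logb 2 (P a))|
          then ∏ i, P (x i) else 0 := by
        convert hmarg
    _ ≤ ∑ x : Fin n → X, Real.exp (-(n * δ)) * ∏ i, q (auxType n x) (x i) := by
        refine Finset.sum_le_sum fun x _ => ?_
        have hnn : 0 ≤ ∏ i, q (auxType n x) (x i) := Finset.prod_nonneg fun i _ => hq _ _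
        split_ifs with hx
        · by_cases hpos : ∀ i, 0 < P (x i)
          · rw [aux_tilt n hn P x hpos (q (auxType n x)) (fun a => rfl)]
            refine mul_le_mul_of_nonneg_right (Real.exp_le_exp.2 ?_) hnn
            rw [hent] at hx
            have hac : ∀ a, P a = 0 → q (auxType n x) a = 0 := by
              intro a ha
              simp only [hqdef]
              rw [aux_type_zero n x a, Nat.cast_zero, zero_div]
              rintro i rfl
              exact (hpos i).ne' ha
            have := aux_core P (q (auxType n x)) hP (hq _) hP1 (hq1 x) hac ε hε hx
            have := mul_le_mul_of_nonneg_left this hn'.le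
            linarith
          · push Not at hpos
            obtain ⟨i, hi⟩ := hpos
            rw [Finset.prod_eq_zero (Finset.mem_univ i) (le_antisymm hi (hP _))]
            positivity
        · positivity
    _ ≤ _ := by
        rw [← Finset.mul_sum, mul_comm]
        exact mul_le_mul_of_nonneg_right (aux_count n q hq hq1) (Real.exp_pos _).le
end

section
/- Let (X_1,Y_1),...,(X_n,Y_n) be i.i.d. from joint distribution p on finite X × Y. The plug-in mutual information estimate satisfies P(|Î(X;Y) − I(X;Y)| > ε) ≤ 3(n+1)^{|X||Y|}·exp(−c̃·n·ε⁴) with c̃ = 1/(32·max{|X|,|Y|}²·log 2). -/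
open Finset
open scoped Classical

section helpers

/-- tangent line bound for `x log (S/x)` -/
lemma mi_tangent (x S Z T : ℝ) (hx : 0 ≤ x) (hS : 0 ≤ S) (h0 : S = 0 → x = 0)
    (hZ : 0 < Z) (hT : 0 < T) :
    x * (Real.log S - Real.log x) ≤ x * (Real.log T - Real.log Z) + S * (Z / T) - x := by
  rcases hx.eq_or_lt with rfl | hx
  · have : 0 ≤ S * (Z / T) := by positivity
    simpa using this
  · have hS' : 0 < S := lt_of_le_of_ne hS (fun h => hx.ne' (h0 h.symm))
    have h1 := Real.log_le_sub_one_of_pos (show 0 < S * Z / (x * T) by positivity)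
    rw [Real.log_div (by positivity) (by positivity), Real.log_mul hS'.ne' hZ.ne',
      Real.log_mul hx.ne' hT.ne'] at h1
    have h2 := mul_le_mul_of_nonneg_left h1 hx.le
    have h3 : x * (S * Z / (x * T) - 1) = S * (Z / T) - x := by field_simp
    rw [h3] at h2
    linarith

lemma mi_logsum {ι : Type*} [Fintype ι] (x S : ι → ℝ) (hx : ∀ i, 0 ≤ x i) (hS : ∀ i, 0 ≤ S i)
    (h0 : ∀ i, S i = 0 → x i = 0) :
    ∑ i, x i * (Real.log (S i) - Real.log (x i)) ≤
      (∑ i, x i) * (Real.log (∑ i, S i) - Real.log (∑ i, x i)) := by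
  rcases (Finset.sum_nonneg (fun i _ => hx i) : 0 ≤ ∑ i, x i).eq_or_lt with h | hZ
  · have : ∀ i, x i = 0 := fun i =>
      (Finset.sum_eq_zero_iff_of_nonneg (fun i _ => hx i)).1 h.symm i (Finset.mem_univ i)
    simp [this]
  · have hT : 0 < ∑ i, S i := by
      refine lt_of_le_of_ne (Finset.sum_nonneg (fun i _ => hS i)) (fun h => hZ.ne' ?_)
      refine Finset.sum_eq_zero (fun i _ => h0 i ?_)
      exact (Finset.sum_eq_zero_iff_of_nonneg (fun i _ => hS i)).1 h.symm i (Finset.mem_univ i)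
    have := Finset.sum_le_sum (fun i (_ : i ∈ Finset.univ) =>
      mi_tangent (x i) (S i) _ _ (hx i) (hS i) (h0 i) hZ hT)
    refine this.trans (le_of_eq ?_)
    rw [Finset.sum_sub_distrib, Finset.sum_add_distrib, ← Finset.sum_mul, ← Finset.sum_mul]
    field_simp
    ring

/-- unnormalised entropy (nats), homogeneous of degree one -/
noncomputable def miPhi {α : Type*} [Fintype α] (u : α → ℝ) : ℝ :=
  ∑ a, u a * (Real.log (∑ a, u a) - Real.log (u a))

lemma miPhi_zero_imp {α : Type*} [Fintype α] (u : α → ℝ) (hu : ∀ a, 0 ≤ u a) (a : α)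
    (h : ∑ a, u a = 0) : u a = 0 :=
  (Finset.sum_eq_zero_iff_of_nonneg (fun i _ => hu i)).1 h a (Finset.mem_univ a)

lemma miPhi_eq {α : Type*} [Fintype α] (u : α → ℝ) :
    miPhi u = ∑ a, Real.negMulLog (u a) - Real.negMulLog (∑ a, u a) := by
  simp only [miPhi, Real.negMulLog, mul_sub, Finset.sum_sub_distrib, ← Finset.sum_mul,
    neg_mul, Finset.sum_neg_distrib]
  ring

lemma miPhi_nonneg {α : Type*} [Fintype α] (u : α → ℝ) (hu : ∀ a, 0 ≤ u a) : 0 ≤ miPhi u := by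
  refine Finset.sum_nonneg (fun a _ => ?_)
  rcases (hu a).eq_or_lt with h | h
  · simp [← h]
  · refine mul_nonneg h.le (sub_nonneg.2 (Real.log_le_log h ?_))
    exact Finset.single_le_sum (fun i _ => hu i) (Finset.mem_univ a)

lemma miPhi_super {α β : Type*} [Fintype α] [Fintype β] (u : β → α → ℝ)
    (hu : ∀ b a, 0 ≤ u b a) : ∑ b, miPhi (u b) ≤ miPhi (fun a => ∑ b, u b a) := by
  unfold miPhi
  rw [Finset.sum_comm]
  refine Finset.sum_le_sum (fun a _ => ?_)
  have := mi_logsum (fun b => u b a) (fun b => ∑ a, u b a) (fun b => hu b a)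
    (fun b => Finset.sum_nonneg (fun a _ => hu b a)) (fun b h => miPhi_zero_imp (u b) (hu b) a h)
  rwa [Finset.sum_comm] at this

lemma miPhi_le {α : Type*} [Fintype α] [Nonempty α] (u : α → ℝ) (hu : ∀ a, 0 ≤ u a) :
    miPhi u ≤ (∑ a, u a) * Real.log (Fintype.card α) := by
  have := mi_logsum u (fun _ => ∑ a, u a) hu (fun _ => Finset.sum_nonneg (fun a _ => hu a))
    (fun a h => miPhi_zero_imp u hu a h)
  refine this.trans (le_of_eq ?_)
  by_cases h : ∑ a, u a = 0
  · simp [h]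
  · rw [Finset.sum_const, nsmul_eq_mul, Real.log_mul _ h]
    · simp
    · simp

lemma mi_nml_add (x y : ℝ) (hx : 0 ≤ x) (hy : 0 ≤ y) :
    Real.negMulLog (x + y) ≤ Real.negMulLog x + Real.negMulLog y := by
  have := miPhi_nonneg (fun b : Bool => if b then x else y) (by intro b; cases b <;> simp [hx, hy])
  rw [miPhi_eq] at this
  simp at this
  linarith

lemma miPhi_add_le {α : Type*} [Fintype α] (u w : α → ℝ) (hu : ∀ a, 0 ≤ u a) (hw : ∀ a, 0 ≤ w a) :
    miPhi (fun a => u a + w a) ≤ miPhi u + miPhi w +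
      miPhi (fun c : Bool => if c then ∑ a, u a else ∑ a, w a) := by
  have h := Finset.sum_le_sum (fun a (_ : a ∈ Finset.univ) => mi_nml_add (u a) (w a) (hu a) (hw a))
  rw [Finset.sum_add_distrib] at h
  rw [miPhi_eq, miPhi_eq, miPhi_eq, miPhi_eq]
  simp [Finset.sum_add_distrib]
  linarith

lemma miPhi_le_add {α : Type*} [Fintype α] (u w : α → ℝ) (hu : ∀ a, 0 ≤ u a) (hw : ∀ a, 0 ≤ w a) :
    miPhi u ≤ miPhi (fun a => u a + w a) := by
  have h := miPhi_super (fun c : Bool => if c then u else w)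
    (by intro b a; cases b <;> simp [hu, hw])
  simp at h
  linarith [miPhi_nonneg w hw]

lemma mi_bin (t : ℝ) (h0 : 0 ≤ t) (h1 : t ≤ 1) :
    miPhi (fun c : Bool => if c then 1 - t else t) ≤ t - t * Real.log t := by
  rw [miPhi_eq]
  simp [Real.negMulLog]
  rcases h1.eq_or_lt with rfl | h
  · simp
  · have := Real.one_sub_inv_le_log_of_pos (sub_pos.2 h)
    have h2 := mul_le_mul_of_nonneg_left this (sub_pos.2 h).le
    have h3 : (1 - t) * (1 - (1 - t)⁻¹) = -t := by
      have := (sub_pos.2 h).ne'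
      field_simp
      ring
    rw [h3] at h2
    linarith

lemma mi_cont {α β : Type*} [Fintype α] [Nonempty α] [Fintype β] (m w : β → α → ℝ) (t : ℝ)
    (hm : ∀ b a, 0 ≤ m b a) (hw : ∀ b a, 0 ≤ w b a)
    (hmt : ∑ b, ∑ a, m b a = 1 - t) (hwt : ∑ b, ∑ a, w b a = t) :
    ∑ b, miPhi (m b) ≤ ∑ b, miPhi (fun a => m b a + w b a) ∧
    ∑ b, miPhi (fun a => m b a + w b a) ≤ ∑ b, miPhi (m b) +
      (t * Real.log (Fintype.card α) + (t - t * Real.log t)) := by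
  constructor
  · exact Finset.sum_le_sum (fun b _ => miPhi_le_add _ _ (hm b) (hw b))
  · have h0 : 0 ≤ t := hwt ▸ Finset.sum_nonneg (fun b _ => Finset.sum_nonneg (fun a _ => hw b a))
    have h1 : 0 ≤ 1 - t :=
      hmt ▸ Finset.sum_nonneg (fun b _ => Finset.sum_nonneg (fun a _ => hm b a))
    have hA := Finset.sum_le_sum (fun b (_ : b ∈ Finset.univ) =>
      miPhi_add_le (m b) (w b) (hm b) (hw b))
    have hB := Finset.sum_le_sum (fun b (_ : b ∈ Finset.univ) => miPhi_le (w b) (hw b))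
    rw [← Finset.sum_mul, hwt] at hB
    have hC := miPhi_super (fun (b : β) (c : Bool) => if c then ∑ a, m b a else ∑ a, w b a)
      (by
        intro b c
        cases c
        · simpa using Finset.sum_nonneg (fun a _ => hw b a)
        · simpa using Finset.sum_nonneg (fun a _ => hm b a))
    have hE : (fun c : Bool => ∑ b, (if c then ∑ a, m b a else ∑ a, w b a))
        = (fun c : Bool => if c then 1 - t else t) := by
      funext c
      cases c
      · simpa using hwt
      · simpa using hmt
    rw [hE] at hC
    have hD := mi_bin t h0 (by linarith)
    rw [Finset.sum_add_distrib, Finset.sum_add_distrib] at hA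
    linarith

/-- mutual information in nats -/
noncomputable def miI {X Y : Type*} [Fintype X] [Fintype Y] (p : X × Y → ℝ) : ℝ :=
  ∑ a, Real.negMulLog (∑ b, p (a, b)) + ∑ b, Real.negMulLog (∑ a, p (a, b))
    - ∑ z, Real.negMulLog (p z)

lemma miI_eq {X Y : Type*} [Fintype X] [Fintype Y] (p : X × Y → ℝ) (hs : ∑ z, p z = 1) :
    miI p = miPhi (fun a => ∑ b, p (a, b)) - ∑ b, miPhi (fun a => p (a, b)) := by
  simp only [miPhi_eq, Finset.sum_sub_distrib]
  rw [← Fintype.sum_prod_type, hs, Finset.sum_comm (s := (univ : Finset Y)),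
    ← Fintype.sum_prod_type (fun z => Real.negMulLog (p z))]
  simp [miI]
  ring

lemma miI_nonneg {X Y : Type*} [Fintype X] [Fintype Y] (p : X × Y → ℝ) (hs : ∑ z, p z = 1)
    (hp : ∀ z, 0 ≤ p z) : 0 ≤ miI p := by
  rw [miI_eq p hs]
  have := miPhi_super (fun b a => p (a, b)) (fun b a => hp _)
  linarith

lemma miI_le {X Y : Type*} [Fintype X] [Nonempty X] [Fintype Y] (p : X × Y → ℝ)
    (hs : ∑ z, p z = 1) (hp : ∀ z, 0 ≤ p z) : miI p ≤ Real.log (Fintype.card X) := by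
  rw [miI_eq p hs]
  have h1 := miPhi_le (fun a => ∑ b, p (a, b)) (fun a => Finset.sum_nonneg (fun b _ => hp _))
  have h2 : 0 ≤ ∑ b, miPhi (fun a => p (a, b)) :=
    Finset.sum_nonneg (fun b _ => miPhi_nonneg _ (fun a => hp _))
  rw [← Fintype.sum_prod_type, hs] at h1
  linarith

lemma miI_cont {X Y : Type*} [Fintype X] [Nonempty X] [Fintype Y] (p q : X × Y → ℝ)
    (hs : ∑ z, p z = 1) (hp : ∀ z, 0 ≤ p z) (hs' : ∑ z, q z = 1) (hq : ∀ z, 0 ≤ q z)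
    (t : ℝ) (ht : ∑ z, (q z - min (p z) (q z)) = t) :
    |miI q - miI p| ≤ 2 * (t * Real.log (Fintype.card X) + (t - t * Real.log t)) := by
  have hm1 : ∑ z, min (p z) (q z) = 1 - t := by
    rw [Finset.sum_sub_distrib] at ht; linarith
  have ht' : ∑ z, (p z - min (p z) (q z)) = t := by
    rw [Finset.sum_sub_distrib]; linarith
  have key : ∀ r : X × Y → ℝ, (∀ z, min (p z) (q z) ≤ r z) → (∑ z, r z = 1) →
      ∑ z, (r z - min (p z) (q z)) = t →
      (miPhi (fun a => ∑ b, min (p (a, b)) (q (a, b))) ≤ miPhi (fun a => ∑ b, r (a, b)) ∧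
      miPhi (fun a => ∑ b, r (a, b)) ≤ miPhi (fun a => ∑ b, min (p (a, b)) (q (a, b))) +
      (t * Real.log (Fintype.card X) + (t - t * Real.log t))) ∧
      (∑ b, miPhi (fun a => min (p (a, b)) (q (a, b))) ≤ ∑ b, miPhi (fun a => r (a, b)) ∧
      ∑ b, miPhi (fun a => r (a, b)) ≤ ∑ b, miPhi (fun a => min (p (a, b)) (q (a, b))) +
      (t * Real.log (Fintype.card X) + (t - t * Real.log t))) := by
    intro r hr hr1 hrt
    have hm0 : ∀ z, 0 ≤ min (p z) (q z) := fun z => le_min (hp z) (hq z)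
    have hr0 : ∀ z, 0 ≤ r z - min (p z) (q z) := fun z => sub_nonneg.2 (hr z)
    constructor
    · have := mi_cont (β := Unit) (fun _ a => ∑ b, min (p (a, b)) (q (a, b)))
        (fun _ a => ∑ b, (r (a, b) - min (p (a, b)) (q (a, b)))) t
        (fun _ a => Finset.sum_nonneg (fun b _ => hm0 _))
        (fun _ a => Finset.sum_nonneg (fun b _ => hr0 _))
        (by rw [← hm1, Fintype.sum_prod_type]; simp)
        (by rw [← hrt, Fintype.sum_prod_type]; simp)
      simpa [← Finset.sum_add_distrib] using this
    · have := mi_cont (fun b a => min (p (a, b)) (q (a, b)))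
        (fun b a => (r (a, b) - min (p (a, b)) (q (a, b)))) t
        (fun _ a => hm0 _) (fun _ a => hr0 _)
        (by rw [← hm1, Fintype.sum_prod_type_right])
        (by rw [← hrt, Fintype.sum_prod_type_right])
      simpa using this
  obtain ⟨⟨a1, a2⟩, a3, a4⟩ := key p (fun z => min_le_left _ _) hs ht'
  obtain ⟨⟨b1, b2⟩, b3, b4⟩ := key q (fun z => min_le_right _ _) hs' ht
  rw [miI_eq p hs, miI_eq q hs', abs_le]
  constructor <;> linarith

lemma mi_scalar (D K t : ℝ) (hD : 0 ≤ D) (hK : 1 ≤ K) (ht : 0 ≤ t) (h1 : D ≤ Real.log K)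
    (h2 : D ≤ 2 * (t * Real.log K + (t - t * Real.log t))) :
    D ^ 4 ≤ 64 * Real.log 2 ^ 5 * K ^ 2 * t ^ 2 := by
  have hK0 : 0 < K := by linarith
  have he1 := Real.exp_one_gt_d9
  have he2 := Real.exp_one_lt_d9
  have hc : (3.19 : ℝ) ^ 2 ≤ 64 * Real.log 2 ^ 5 := by
    have : (0.6931471803 : ℝ) ^ 5 ≤ Real.log 2 ^ 5 :=
      pow_le_pow_left₀ (by norm_num) Real.log_two_gt_d9.le 5
    norm_num at this ⊢
    linarith
  have hmain : D ^ 2 ≤ 3.19 * K * t := by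
    rcases ht.eq_or_lt with rfl | ht
    · have : D = 0 := le_antisymm (by simpa using h2) hD
      simp [this]
    · obtain ⟨y, hy⟩ : ∃ y, y = Real.log K - Real.log t := ⟨_, rfl⟩
      have hKy : K = t * Real.exp y := by
        rw [hy, Real.exp_sub, Real.exp_log hK0, Real.exp_log ht]; field_simp
      have h3 : Real.exp 3 = Real.exp 1 ^ 3 := by rw [← Real.exp_nat_mul]; norm_num
      by_cases hy3 : 3 ≤ y
      · have h2' : D ≤ 2 * t * (1 + y) := by rw [hy]; linarith
        have e1 := Real.add_one_le_exp ((y - 3) / 2)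
        have e2 : Real.exp y = Real.exp 1 ^ 3 * Real.exp ((y - 3) / 2) ^ 2 := by
          rw [← h3, ← Real.exp_nat_mul, ← Real.exp_add]; congr 1; push_cast; ring
        have e3 : (1 + y) ^ 2 ≤ 16 * Real.exp ((y - 3) / 2) ^ 2 := by
          have : (1 + y) ^ 2 ≤ (4 * Real.exp ((y - 3) / 2)) ^ 2 :=
            pow_le_pow_left₀ (by linarith) (by linarith) 2
          linarith [this, mul_pow 4 (Real.exp ((y - 3) / 2)) 2]
        have e4 : (64 : ℝ) ≤ 3.19 * Real.exp 1 ^ 3 := by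
          have : (2.7182818283 : ℝ) ^ 3 ≤ Real.exp 1 ^ 3 :=
            pow_le_pow_left₀ (by norm_num) he1.le 3
          norm_num at this ⊢
          linarith
        have e5 : 4 * (1 + y) ^ 2 ≤ 3.19 * Real.exp y := by
          rw [e2]
          have := mul_le_mul_of_nonneg_right e4 (sq_nonneg (Real.exp ((y - 3) / 2)))
          linarith
        calc D ^ 2 ≤ (2 * t * (1 + y)) ^ 2 := pow_le_pow_left₀ hD h2' 2
          _ = t ^ 2 * (4 * (1 + y) ^ 2) := by ring
          _ ≤ t ^ 2 * (3.19 * Real.exp y) := by gcongr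
          _ = 3.19 * K * t := by rw [hKy]; ring
      · push Not at hy3
        have f1 : K ≤ t * Real.exp 1 ^ 3 := by
          rw [hKy, ← h3]; gcongr
        have f2 : Real.log K ≤ K / Real.exp 1 := by
          have := Real.log_le_sub_one_of_pos (show 0 < K / Real.exp 1 by positivity)
          rw [Real.log_div hK0.ne' (Real.exp_pos 1).ne', Real.log_exp] at this
          linarith
        have hE := Real.exp_pos 1
        calc D ^ 2 ≤ (K / Real.exp 1) ^ 2 := pow_le_pow_left₀ hD (h1.trans f2) 2
          _ = K * K / Real.exp 1 ^ 2 := by ring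
          _ ≤ K * (t * Real.exp 1 ^ 3) / Real.exp 1 ^ 2 := by gcongr
          _ = Real.exp 1 * K * t := by field_simp
          _ ≤ 3.19 * K * t := by gcongr; linarith
  calc D ^ 4 = (D ^ 2) ^ 2 := by ring
    _ ≤ (3.19 * K * t) ^ 2 := pow_le_pow_left₀ (by positivity) hmain 2
    _ = 3.19 ^ 2 * (K ^ 2 * t ^ 2) := by ring
    _ ≤ 64 * Real.log 2 ^ 5 * (K ^ 2 * t ^ 2) := by gcongr
    _ = _ := by ring

end helpers

section prob

open MeasureTheory ProbabilityTheory in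
lemma mi_hoeffding_one {Z : Type*} [Fintype Z] (p : Z → ℝ) (hp : ∀ z, 0 ≤ p z)
    (hs : ∑ z, p z = 1) (f : Z → ℝ) (a : ℝ) (hf : ∀ z, f z ∈ Set.Icc a (a + 1))
    (hm : ∑ z, p z * f z = 0) (l : ℝ) :
    ∑ z, p z * Real.exp (l * f z) ≤ Real.exp (l ^ 2 / 8) := by
  let _ : MeasurableSpace Z := ⊤
  have : DiscreteMeasurableSpace Z := ⟨fun _ => trivial⟩
  let P : PMF Z := PMF.ofFintype (fun z => ENNReal.ofReal (p z)) (by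
    rw [← ENNReal.ofReal_sum_of_nonneg (fun z _ => hp z), hs, ENNReal.ofReal_one])
  have hint : ∀ g : Z → ℝ, ∫ z, g z ∂P.toMeasure = ∑ z, p z * g z := by
    intro g
    rw [PMF.integral_eq_sum]
    simp [P, ENNReal.toReal_ofReal (hp _)]
  have h := hasSubgaussianMGF_of_mem_Icc_of_integral_eq_zero (μ := P.toMeasure) (X := f)
    (a := a) (b := a + 1) (Measurable.of_discrete).aemeasurable (Filter.Eventually.of_forall hf)
    (by rw [hint, hm])
  have h2 := h.mgf_le l
  rw [mgf, hint] at h2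
  refine h2.trans (le_of_eq ?_)
  congr 1
  simp
  ring

lemma mi_hoeffding {Z : Type*} [Fintype Z] (p : Z → ℝ) (hp : ∀ z, 0 ≤ p z)
    (hs : ∑ z, p z = 1) (f : Z → ℝ) (a : ℝ) (hf : ∀ z, f z ∈ Set.Icc a (a + 1))
    (hm : ∑ z, p z * f z = 0) (n : ℕ) (t : ℝ) (E : Finset (Fin n → Z)) (ht : 0 ≤ t)
    (hE : ∀ w ∈ E, n * t ≤ ∑ i, f (w i)) :
    ∑ w ∈ E, ∏ i, p (w i) ≤ Real.exp (-(2 * n * t ^ 2)) := by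
  have hpn : ∀ w : Fin n → Z, 0 ≤ ∏ i, p (w i) := fun w => Finset.prod_nonneg (fun i _ => hp _)
  have h1 : ∑ w ∈ E, ∏ i, p (w i) ≤
      ∑ w : Fin n → Z, Real.exp (-(4 * t * (n * t))) * ∏ i, (p (w i) * Real.exp (4 * t * f (w i))) := by
    have hrw : ∀ w : Fin n → Z, Real.exp (-(4 * t * (n * t))) *
        ∏ i, (p (w i) * Real.exp (4 * t * f (w i))) =
        (∏ i, p (w i)) * Real.exp (4 * t * (∑ i, f (w i) - n * t)) := by
      intro w
      rw [Finset.prod_mul_distrib, ← Real.exp_sum, ← Finset.mul_sum, mul_left_comm, ← Real.exp_add]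
      congr 2
      ring
    simp_rw [hrw]
    calc ∑ w ∈ E, ∏ i, p (w i)
        ≤ ∑ w ∈ E, (∏ i, p (w i)) * Real.exp (4 * t * (∑ i, f (w i) - n * t)) := by
          refine Finset.sum_le_sum (fun w hw => le_mul_of_one_le_right (hpn w) ?_)
          exact Real.one_le_exp (mul_nonneg (by positivity) (sub_nonneg.2 (hE w hw)))
      _ ≤ _ := Finset.sum_le_sum_of_subset_of_nonneg (Finset.subset_univ _)
          (fun w _ _ => mul_nonneg (hpn w) (Real.exp_pos _).le)
  refine h1.trans ?_
  rw [← Finset.mul_sum, ← Fintype.sum_pow (fun z => p z * Real.exp (4 * t * f z))]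
  have h2 := mi_hoeffding_one p hp hs f a hf hm (4 * t)
  have h3 := pow_le_pow_left₀ (Finset.sum_nonneg (fun z _ => mul_nonneg (hp z) (Real.exp_pos _).le))
    h2 n
  refine (mul_le_mul_of_nonneg_left h3 (Real.exp_pos _).le).trans (le_of_eq ?_)
  rw [← Real.exp_nat_mul, ← Real.exp_add]
  congr 1
  ring

lemma mi_biUnion {ι κ : Type*} [DecidableEq κ] (s : Finset ι) (F : ι → Finset κ) (g : κ → ℝ)
    (hg : ∀ w, 0 ≤ g w) : ∑ w ∈ s.biUnion F, g w ≤ ∑ A ∈ s, ∑ w ∈ F A, g w := by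
  induction s using Finset.induction_on with
  | empty => simp
  | insert a s ha ih =>
    rw [Finset.biUnion_insert, Finset.sum_insert ha]
    have h := Finset.sum_union_inter (s₁ := F a) (s₂ := s.biUnion F) (f := g)
    have h' : 0 ≤ ∑ w ∈ F a ∩ s.biUnion F, g w := Finset.sum_nonneg (fun w _ => hg w)
    linarith

/-- Bretagnolle–Huber–Carol -/
lemma mi_bhc {Z : Type*} [Fintype Z] (p : Z → ℝ) (hp : ∀ z, 0 ≤ p z)
    (hs : ∑ z, p z = 1) (n : ℕ) (hn : 0 < n) (t : ℝ) (ht : 0 ≤ t)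
    (q : (Fin n → Z) → Z → ℝ)
    (hq : ∀ w z, q w z = ∑ i, if w i = z then 1 / (n : ℝ) else 0)
    (E : Finset (Fin n → Z))
    (hE : ∀ w ∈ E, t ≤ ∑ z, (q w z - min (p z) (q w z))) :
    ∑ w ∈ E, ∏ i, p (w i) ≤ 2 ^ (Fintype.card Z) * Real.exp (-(2 * n * t ^ 2)) := by
  have hpn : ∀ w : Fin n → Z, 0 ≤ ∏ i, p (w i) := fun w => Finset.prod_nonneg (fun i _ => hp _)
  let f : Finset Z → Z → ℝ := fun A z => (if z ∈ A then 1 else 0) - ∑ y ∈ A, p y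
  let F : Finset Z → Finset (Fin n → Z) := fun A => univ.filter (fun w => n * t ≤ ∑ i, f A (w i))
  have hn' : (n : ℝ) ≠ 0 := by positivity
  have hsub : E ⊆ (univ : Finset (Finset Z)).biUnion F := by
    intro w hw
    refine Finset.mem_biUnion.2 ⟨univ.filter (fun z => p z < q w z), Finset.mem_univ _, ?_⟩
    refine Finset.mem_filter.2 ⟨Finset.mem_univ _, ?_⟩
    have h1 : ∑ z, (q w z - min (p z) (q w z)) =
        ∑ z ∈ univ.filter (fun z => p z < q w z), (q w z - p z) := by
      rw [Finset.sum_filter]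
      refine Finset.sum_congr rfl (fun z _ => ?_)
      split_ifs with h
      · rw [min_eq_left h.le]
      · rw [min_eq_right (not_lt.1 h), sub_self]
    have h2 := hE w hw
    rw [h1] at h2
    generalize univ.filter (fun z => p z < q w z) = A at h2
    have h3 : ∑ i, f A (w i) = n * ∑ z ∈ A, (q w z - p z) := by
      have h4 : ∑ z ∈ A, q w z = ∑ i, if w i ∈ A then 1 / (n : ℝ) else 0 := by
        simp only [hq]
        rw [Finset.sum_comm]
        exact Finset.sum_congr rfl (fun i _ => Finset.sum_ite_eq _ _ _)
      have h5 : ∑ z ∈ A, (q w z - p z) = (∑ i, if w i ∈ A then 1 / (n : ℝ) else 0)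
          - ∑ z ∈ A, p z := by
        rw [Finset.sum_sub_distrib, h4]
      rw [h5, mul_sub, Finset.mul_sum]
      simp only [f, Finset.sum_sub_distrib, mul_ite, mul_one_div_cancel hn', mul_zero]
      simp
    rw [h3]
    gcongr
  have hA : ∀ A, ∑ w ∈ F A, ∏ i, p (w i) ≤ Real.exp (-(2 * n * t ^ 2)) := by
    intro A
    refine mi_hoeffding p hp hs (f A) (-∑ y ∈ A, p y) ?_ ?_ n t (F A) ht
      (fun w hw => (Finset.mem_filter.1 hw).2)
    · intro z
      simp only [f, Set.mem_Icc]
      split_ifs <;> constructor <;> linarith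
    · simp only [f, mul_sub, Finset.sum_sub_distrib, ← Finset.sum_mul, hs]
      simp
  calc ∑ w ∈ E, ∏ i, p (w i)
      ≤ ∑ w ∈ (univ : Finset (Finset Z)).biUnion F, ∏ i, p (w i) :=
        Finset.sum_le_sum_of_subset_of_nonneg hsub (fun w _ _ => hpn w)
    _ ≤ ∑ A : Finset Z, ∑ w ∈ F A, ∏ i, p (w i) :=
        mi_biUnion _ _ _ hpn
    _ ≤ ∑ A : Finset Z, Real.exp (-(2 * n * t ^ 2)) := Finset.sum_le_sum (fun A _ => hA A)
    _ = _ := by simp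

lemma mi_nml {ι : Type*} [Fintype ι] (g : ι → ℝ) :
    -∑ i, g i * Real.logb 2 (g i) = (∑ i, Real.negMulLog (g i)) / Real.log 2 := by
  rw [Finset.sum_div, ← Finset.sum_neg_distrib]
  refine Finset.sum_congr rfl (fun i _ => ?_)
  simp only [Real.negMulLog, Real.logb]
  ring

lemma mi_ent {n : ℕ} {β : Type*} [Fintype β] [DecidableEq β] (V : Fin n → β) :
    ent (unif n) V =
      (∑ b, Real.negMulLog (∑ i, if V i = b then 1 / (n : ℝ) else 0)) / Real.log 2 := by
  unfold ent unif
  rw [mi_nml]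
  simp only [Finset.sum_filter]

end prob

/-- Concentration of the plug-in mutual information estimate: for `n` i.i.d. samples from a
joint distribution `p` on a finite space `X × Y`,
`P(|Î(X;Y) − I(X;Y)| > ε) ≤ 3(n+1)^{|X||Y|}·exp(−c̃·n·ε⁴)` with
`c̃ = 1/(32·max{|X|,|Y|}²·log 2)`. -/
theorem stmt16 {X Y : Type*} [Fintype X] [DecidableEq X] [Fintype Y] [DecidableEq Y]
    (n : ℕ) (hn : 0 < n) (p : X × Y → ℝ) (hp : ∀ z, 0 ≤ p z) (hsum : ∑ z, p z = 1)
    (ε : ℝ) (hε : 0 < ε) :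
    (∑ ω ∈ univ.filter (fun ω : Fin n → X × Y =>
        ε < |(ent (unif n) (fun i => (ω i).1) + ent (unif n) (fun i => (ω i).2)
                - ent (unif n) ω)
              - ((-∑ a : X, (∑ b : Y, p (a, b)) * Real.logb 2 (∑ b : Y, p (a, b)))
                  + (-∑ b : Y, (∑ a : X, p (a, b)) * Real.logb 2 (∑ a : X, p (a, b)))
                  - (-∑ z : X × Y, p z * Real.logb 2 (p z)))|),
      ∏ i, p (ω i))
      ≤ 3 * ((n : ℝ) + 1) ^ (Fintype.card X * Fintype.card Y) *
          Real.exp (-(1 / (32 * ((max (Fintype.card X) (Fintype.card Y) : ℕ) : ℝ)^2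
              * Real.log 2)) * n * ε^4) := by
  have hXY : Nonempty (X × Y) := by
    by_contra h
    rw [not_nonempty_iff] at h
    simp at hsum
  have hX : Nonempty X := hXY.map Prod.fst
  have hn' : (n : ℝ) ≠ 0 := by positivity
  have hl : 0 < Real.log 2 := Real.log_pos (by norm_num)
  obtain ⟨K, hK⟩ : ∃ K : ℕ, K = max (Fintype.card X) (Fintype.card Y) := ⟨_, rfl⟩
  rw [← hK]
  have hXK : (Fintype.card X : ℝ) ≤ K := by
    rw [hK]; exact_mod_cast le_max_left _ _
  have hX1 : (1 : ℝ) ≤ Fintype.card X := by exact_mod_cast Fintype.card_pos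
  have hK1 : (1 : ℝ) ≤ K := hX1.trans hXK
  have hK0 : (0 : ℝ) < K := by linarith
  let q : (Fin n → X × Y) → X × Y → ℝ := fun w z => ∑ i, if w i = z then 1 / (n : ℝ) else 0
  have hq0 : ∀ w z, 0 ≤ q w z := fun w z => Finset.sum_nonneg (fun i _ => by positivity)
  have hq1 : ∀ w, ∑ z, q w z = 1 := by
    intro w
    simp only [q]
    rw [Finset.sum_comm]
    simp [hn']
  have hqe : ∀ w : Fin n → X × Y, ent (unif n) (fun i => (w i).1) + ent (unif n) (fun i => (w i).2)
      - ent (unif n) w = miI (q w) / Real.log 2 := by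
    intro w
    rw [mi_ent, mi_ent, mi_ent, miI, ← add_div, ← sub_div]
    have e1 : ∀ a, ∑ b, q w (a, b) = ∑ i, if (w i).1 = a then 1 / (n : ℝ) else 0 := by
      intro a
      simp only [q]
      rw [Finset.sum_comm]
      refine Finset.sum_congr rfl (fun i _ => ?_)
      by_cases h : (w i).1 = a <;> simp [Prod.ext_iff, h]
    have e2 : ∀ b, ∑ a, q w (a, b) = ∑ i, if (w i).2 = b then 1 / (n : ℝ) else 0 := by
      intro b
      simp only [q]
      rw [Finset.sum_comm]
      refine Finset.sum_congr rfl (fun i _ => ?_)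
      by_cases h : (w i).2 = b <;> simp [Prod.ext_iff, h]
    simp only [e1, e2]
    rfl
  have hpe : ((-∑ a : X, (∑ b : Y, p (a, b)) * Real.logb 2 (∑ b : Y, p (a, b)))
      + (-∑ b : Y, (∑ a : X, p (a, b)) * Real.logb 2 (∑ a : X, p (a, b)))
      - (-∑ z : X × Y, p z * Real.logb 2 (p z))) = miI p / Real.log 2 := by
    rw [mi_nml, mi_nml, mi_nml, miI, ← add_div, ← sub_div]
  rw [hpe]
  simp only [hqe]
  obtain ⟨t, htd⟩ : ∃ t, t = ε ^ 2 / (8 * K * √(Real.log 2)) := ⟨_, rfl⟩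
  have hsq : 0 < √(Real.log 2) := Real.sqrt_pos.2 hl
  have ht0 : 0 ≤ t := by rw [htd]; positivity
  have ht2 : t ^ 2 = ε ^ 4 / (64 * K ^ 2 * Real.log 2) := by
    rw [htd, div_pow, mul_pow, Real.sq_sqrt hl.le]; ring
  have hb := mi_bhc p hp hsum n hn t ht0 q (fun w z => by simp only [q]; congr!)
    (univ.filter (fun w => ε < |miI (q w) / Real.log 2 - miI p / Real.log 2|)) (by
      intro w hw
      have hw := (Finset.mem_filter.1 hw).2
      rw [← sub_div, abs_div, abs_of_pos hl, lt_div_iff₀ hl] at hw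
      obtain ⟨s, hs⟩ : ∃ s, ∑ z, (q w z - min (p z) (q w z)) = s := ⟨_, rfl⟩
      rw [hs]
      have hs0 : 0 ≤ s := by
        rw [← hs]; exact Finset.sum_nonneg (fun z _ => sub_nonneg.2 (min_le_right _ _))
      have hlog : Real.log (Fintype.card X) ≤ Real.log K := Real.log_le_log (by linarith) hXK
      have h1 := miI_cont p (q w) hsum hp (hq1 w) (hq0 w) s hs
      have h2 : |miI (q w) - miI p| ≤ Real.log K := by
        have a1 := miI_nonneg p hsum hp
        have a2 := miI_nonneg (q w) (hq1 w) (hq0 w)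
        have a3 := miI_le p hsum hp
        have a4 := miI_le (q w) (hq1 w) (hq0 w)
        rw [abs_le]
        constructor <;> linarith
      have h3 : s * Real.log (Fintype.card X) ≤ s * Real.log K :=
        mul_le_mul_of_nonneg_left hlog hs0
      have h4 := mi_scalar _ K s (abs_nonneg _) hK1 hs0 h2 (by linarith)
      have h5 : (ε * Real.log 2) ^ 4 ≤ 64 * Real.log 2 ^ 5 * K ^ 2 * s ^ 2 :=
        (pow_le_pow_left₀ (by positivity) hw.le 4).trans h4
      refine le_of_sq_le_sq ?_ hs0
      rw [ht2, div_le_iff₀ (by positivity)]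
      have h6 : 0 < Real.log 2 ^ 4 := by positivity
      refine le_of_mul_le_mul_right ?_ h6
      calc ε ^ 4 * Real.log 2 ^ 4 = (ε * Real.log 2) ^ 4 := by ring
        _ ≤ _ := h5
        _ = _ := by ring)
  refine le_trans (le_of_eq ?_) (hb.trans ?_)
  · congr
  · have hexp : -(1 / (32 * (K : ℝ) ^ 2 * Real.log 2)) * n * ε ^ 4 = -(2 * n * t ^ 2) := by
      rw [ht2]; field_simp; norm_num
    rw [hexp, Fintype.card_prod]
    have h1n : (1 : ℝ) ≤ n := by exact_mod_cast hn
    have hpow : (2 : ℝ) ^ (Fintype.card X * Fintype.card Y) ≤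
        ((n : ℝ) + 1) ^ (Fintype.card X * Fintype.card Y) :=
      pow_le_pow_left₀ (by norm_num) (by linarith) _
    have hpos : 0 < ((n : ℝ) + 1) ^ (Fintype.card X * Fintype.card Y) := by positivity
    refine mul_le_mul_of_nonneg_right ?_ (Real.exp_pos _).le
    linarith
end
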